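/- Under the standing assumptions, and with E_0 a constant as specified, there exists L_1 > 0 such that for every natural number L > L_1, every ε > 0, and every n ∈ ℕ with ⌈εn⌉ ≥ 1, every g ∈ W_{L,ε}(n) is a loxodromic isometry of X with the WPD property. -/

import Mathlib

namespace AcylCount

/-! ### Geodesic segments and Gromov hyperbolicity -/

/-- A finite geodesic segment in a metric space, parametrized by arclength on `[0, len]`,
oriented from `initial := toFun 0` to `terminal := toFun len`. -/
structure GeodesicSegment (X : Type*) [MetricSpace X] where
  len : ℝ
  len_nonneg : 0 ≤ len
  toFun : ℝ → X
  isom : ∀ s ∈ Set.Icc (0:ℝ) len, ∀ t ∈ Set.Icc (0:ℝ) len,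
    dist (toFun s) (toFun t) = |s - t|

namespace GeodesicSegment

variable {X : Type*} [MetricSpace X]

/-- The initial point of a geodesic segment. -/
def initial (γ : GeodesicSegment X) : X := γ.toFun 0

/-- The terminal point of a geodesic segment. -/
def terminal (γ : GeodesicSegment X) : X := γ.toFun γ.len

/-- The image (underlying set) of a geodesic segment. -/
def seg (γ : GeodesicSegment X) : Set X := γ.toFun '' Set.Icc 0 γ.len

/-- The translate of a geodesic segment by an isometry. -/
def translate (γ : GeodesicSegment X) (f : X → X) (hf : Isometry f) :
    GeodesicSegment X where
  len := γ.len
  len_nonneg := γ.len_nonneg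
  toFun := f ∘ γ.toFun
  isom := fun s hs t ht => by
    simp only [Function.comp_apply, hf.dist_eq]
    exact γ.isom s hs t ht

/-- The degenerate geodesic segment consisting of a single point. -/
def point (p : X) : GeodesicSegment X where
  len := 0
  len_nonneg := le_refl 0
  toFun := fun _ => p
  isom := fun s hs t ht => by
    have hs0 : s = 0 := le_antisymm hs.2 hs.1
    have ht0 : t = 0 := le_antisymm ht.2 ht.1
    simp [hs0, ht0]

/-- `η` is a subsegment of `γ`. -/
def IsSubsegment (η γ : GeodesicSegment X) : Prop :=
  ∃ a b : ℝ, 0 ≤ a ∧ a ≤ b ∧ b ≤ γ.len ∧ η.len = b - a ∧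
    ∀ t ∈ Set.Icc (0:ℝ) η.len, η.toFun t = γ.toFun (a + t)

/-- `p` occurs (weakly) before `q` along the oriented geodesic segment `γ`. -/
def Before (γ : GeodesicSegment X) (p q : X) : Prop :=
  ∃ s t : ℝ, s ∈ Set.Icc (0:ℝ) γ.len ∧ t ∈ Set.Icc (0:ℝ) γ.len ∧ s ≤ t ∧
    γ.toFun s = p ∧ γ.toFun t = q

end GeodesicSegment

/-- A geodesic metric space: every two points are joined by a geodesic segment. -/
def IsGeodesicSpace (X : Type*) [MetricSpace X] : Prop :=
  ∀ x y : X, ∃ γ : GeodesicSegment X, γ.initial = x ∧ γ.terminal = y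

/-- δ-hyperbolicity via slim triangles: each side of a geodesic triangle lies in the
closed δ-neighborhood of the union of the other two sides. -/
def IsDeltaHyperbolic (X : Type*) [MetricSpace X] (δ : ℝ) : Prop :=
  ∀ γ₁ γ₂ γ₃ : GeodesicSegment X,
    γ₁.initial = γ₃.initial → γ₁.terminal = γ₂.initial → γ₂.terminal = γ₃.terminal →
    γ₃.seg ⊆ Metric.cthickening δ (γ₁.seg ∪ γ₂.seg)

variable {X : Type*} [MetricSpace X]

/-- The closest point projection of `x` to (the image of) the geodesic `γ`. -/
def proj (γ : GeodesicSegment X) (x : X) : Set X :=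
  {p | p ∈ γ.seg ∧ dist x p = Metric.infDist x γ.seg}

/-- The closest point projection of a set `A` to the geodesic `γ`. -/
def projSet (γ : GeodesicSegment X) (A : Set X) : Set X :=
  ⋃ a ∈ A, proj γ a

/-- The ordered pair of oriented geodesic segments `(γ, η)` is `K`-aligned. -/
def AlignedPair (K : ℝ) (γ η : GeodesicSegment X) : Prop :=
  Metric.diam (projSet γ η.seg ∪ {γ.terminal}) < K ∧
  Metric.diam (projSet η γ.seg ∪ {η.initial}) < K

/-- A sequence of oriented geodesic segments is `K`-aligned if each consecutive
pair is `K`-aligned. -/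
def AlignedSeq (K : ℝ) (l : List (GeodesicSegment X)) : Prop :=
  l.Chain' (AlignedPair K)

/-- The Gromov product `(y, z)_x`. -/
noncomputable def gromovProd (x y z : X) : ℝ := (dist y x + dist x z - dist y z) / 2

/-! ### Word metric -/

variable {G : Type*} [Group G]

/-- The word length of `g` with respect to the (symmetrized) generating set `S`. -/
noncomputable def wordLength (S : Finset G) (g : G) : ℕ :=
  sInf {n | ∃ l : List G, l.length = n ∧ (∀ x ∈ l, x ∈ S ∨ x⁻¹ ∈ S) ∧ l.prod = g}

/-- The word metric on `G` with respect to `S`. -/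
noncomputable def wordDist (S : Finset G) (g h : G) : ℕ := wordLength S (g⁻¹ * h)

/-- The ball of radius `r` in the word metric, centered at the identity. -/
def ball (S : Finset G) (r : ℝ) : Set G := {g | (wordLength S g : ℝ) ≤ r}

/-- `G` has no cyclic subgroup of finite index. -/
def NonVirtuallyCyclic (G : Type*) [Group G] : Prop :=
  ¬ ∃ H : Subgroup G, H.FiniteIndex ∧ IsCyclic H

/-! ### Isometric actions, loxodromics, WPD -/

/-- `g` is a loxodromic isometry for the action `ρ` with basepoint `x0`: the asymptotic
translation length `τ_X(g) = lim dist x0 (g^n x0) / n` exists and is positive. -/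
def IsLoxodromic (ρ : G → X → X) (x0 : X) (g : G) : Prop :=
  ∃ τ : ℝ, 0 < τ ∧
    Filter.Tendsto (fun n : ℕ => dist x0 (ρ (g ^ n) x0) / n) Filter.atTop (nhds τ)

/-- The WPD (weak proper discontinuity) property of `g` for the action `ρ` with
basepoint `x0`. -/
def HasWPD (ρ : G → X → X) (x0 : X) (g : G) : Prop :=
  ∀ K : ℝ, 0 < K → ∃ N M : ℕ,
    {h : G | dist x0 (ρ h x0) < K ∧ dist (ρ (g ^ N) x0) (ρ h (ρ (g ^ N) x0)) < K}.Finite ∧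
    {h : G | dist x0 (ρ h x0) < K ∧ dist (ρ (g ^ N) x0) (ρ h (ρ (g ^ N) x0)) < K}.ncard < M

/-- The list of translated geodesics `h 1 • Υ, …, h m • Υ`. -/
def transList (ρ : G → X → X) (hisom : ∀ g : G, Isometry (ρ g))
    (Υ : GeodesicSegment X) (h : ℕ → G) (m : ℕ) : List (GeodesicSegment X) :=
  (List.range m).map fun i => Υ.translate (ρ (h (i + 1))) (hisom _)

/-- The specification of the constant `E₀` from Fact 2.7 (Bestvina–Fujiwara):
(i) Gromov product bounds, (ii) the WPD-type conclusion for large projections. -/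
def E0Spec (S : Finset G) (ρ : G → X → X) (x0 : X) (φ : G) (E0 : ℝ) : Prop :=
  0 < E0 ∧
  (∀ g : G, ∃ s t : G, (s ∈ S ∨ s = 1) ∧ (t ∈ S ∨ t = 1) ∧
    (∀ i : ℤ, 0 < i → gromovProd x0 (ρ (φ ^ i) x0) (ρ (s * g) x0) ≤ E0) ∧
    (∀ j : ℤ, j < 0 → gromovProd x0 (ρ (φ ^ j) x0) (ρ (t * g) x0) ≤ E0)) ∧
  (∀ n : ℕ, 0 < n → ∀ g : G, ∀ γ : GeodesicSegment X,
    γ.initial = x0 → γ.terminal = ρ (φ ^ n) x0 →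
    ∀ p ∈ proj γ (ρ g x0), ∀ q ∈ proj γ (ρ (g * φ ^ n) x0),
      γ.Before p q → E0 < dist p q →
      ∃ i j : ℕ, i ≤ n ∧ j ≤ n ∧ (wordDist S (φ ^ i) (g * φ ^ j) : ℝ) < E0)

/-- The set `V_{L,ε}(n)`. Here `Υ` is the chosen geodesic `Υ_L = [x₀, φ^L x₀]`. -/
def Vset (S : Finset G) (ρ : G → X → X) (hisom : ∀ g : G, Isometry (ρ g)) (x0 : X)
    (δ E0 : ℝ) (Υ : GeodesicSegment X) (ε : ℝ) (n : ℕ) : Set G :=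
  {g | g ∈ ball S (n:ℝ) ∧ ∃ h : ℕ → G,
    AlignedSeq (6 * E0 + 300 * δ)
      ([GeodesicSegment.point x0] ++ transList ρ hisom Υ h ⌈ε * (n:ℝ)⌉₊ ++
        [GeodesicSegment.point (ρ g x0)])}

/-- The set `W_{L,ε}(n)`. Here `Υ` is the chosen geodesic `Υ_L = [x₀, φ^L x₀]`. -/
def Wset (S : Finset G) (ρ : G → X → X) (hisom : ∀ g : G, Isometry (ρ g)) (x0 : X)
    (δ E0 : ℝ) (Υ : GeodesicSegment X) (ε : ℝ) (n : ℕ) : Set G :=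
  {g | g ∈ ball S (n:ℝ) ∧ ∃ h : ℕ → G,
    AlignedSeq (6 * E0 + 360 * δ)
      ([GeodesicSegment.point x0] ++ transList ρ hisom Υ h ⌈ε * (n:ℝ)⌉₊ ++
        [GeodesicSegment.point (ρ g x0)]) ∧
    AlignedPair (6 * E0 + 360 * δ) (GeodesicSegment.point (ρ g⁻¹ x0))
      (Υ.translate (ρ (h 1)) (hisom _)) ∧
    AlignedPair (6 * E0 + 360 * δ) (Υ.translate (ρ (h ⌈ε * (n:ℝ)⌉₊)) (hisom _))
      (GeodesicSegment.point (ρ (g ^ 2) x0))}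

/-- The set `BAD_{L,ε}(n)`. -/
def BADset (S : Finset G) (ρ : G → X → X) (hisom : ∀ g : G, Isometry (ρ g)) (x0 : X)
    (δ E0 : ℝ) (Υ : GeodesicSegment X) (ε : ℝ) (n : ℕ) : Set G :=
  ball S (n:ℝ) \ (ball S ((⌊(0.9:ℝ) * (n:ℝ)⌋₊ : ℕ) : ℝ) ∪ Vset S ρ hisom x0 δ E0 Υ ε n)

/-! ### Paths in the word metric -/

/-- `P` is a `d_S`-path connecting `a` to `b`. -/
noncomputable def IsPathFrom (S : Finset G) (P : List G) (a b : G) : Prop :=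
  P ≠ [] ∧ P.Chain' (fun u v => wordDist S u v = 1) ∧ P.head? = some a ∧ P.getLast? = some b

/-- The distance `d_S(P, g)` from a path `P` to a group element `g`. -/
noncomputable def pathDist (S : Finset G) (P : List G) (g : G) : ℕ :=
  sInf {d | ∃ v ∈ P, d = wordDist S v g}


/-! ### The four-point condition -/

/-- The four-point condition with constant `κ`: among the three sums of distances of opposite
pairs of points, each one is at most `κ` plus one of the other two. -/
def FourPoint (X : Type*) [MetricSpace X] (κ : ℝ) : Prop :=
  ∀ x y z w : X, dist x z + dist y w ≤ dist x y + dist z w + κ ∨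
    dist x z + dist y w ≤ dist y z + dist x w + κ

/-- `a` lies between `x` and `y` up to an error `C`: twice the Gromov product `(x, y)_a` is at
most `C`. -/
def AlmostBetween (C : ℝ) (x a y : X) : Prop := dist x a + dist a y ≤ dist x y + C

namespace GeodesicSegment

theorem initial_mem (γ : GeodesicSegment X) : γ.initial ∈ γ.seg :=
  ⟨0, ⟨le_refl 0, γ.len_nonneg⟩, rfl⟩

theorem terminal_mem (γ : GeodesicSegment X) : γ.terminal ∈ γ.seg :=
  ⟨γ.len, ⟨γ.len_nonneg, le_refl _⟩, rfl⟩

theorem dist_initial_terminal (γ : GeodesicSegment X) :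
    dist γ.initial γ.terminal = γ.len := by
  have := γ.isom 0 ⟨le_refl 0, γ.len_nonneg⟩ γ.len ⟨γ.len_nonneg, le_refl _⟩
  rw [zero_sub, abs_neg, abs_of_nonneg γ.len_nonneg] at this
  exact this

theorem dist_add_dist_of_mem (γ : GeodesicSegment X) {p : X} (hp : p ∈ γ.seg) :
    dist γ.initial p + dist p γ.terminal = dist γ.initial γ.terminal := by
  obtain ⟨s, hs, rfl⟩ := hp
  have h1 := γ.isom 0 ⟨le_refl 0, γ.len_nonneg⟩ s hs
  have h2 := γ.isom s hs γ.len ⟨γ.len_nonneg, le_refl _⟩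
  rw [γ.dist_initial_terminal, initial, terminal, h1, h2, zero_sub, abs_neg, abs_of_nonneg hs.1,
    abs_of_nonpos (by linarith [hs.2])]
  ring

theorem exists_mem_dist_eq (γ : GeodesicSegment X) {t : ℝ} (h0 : 0 ≤ t)
    (ht : t ≤ dist γ.initial γ.terminal) : ∃ p ∈ γ.seg, dist γ.initial p = t := by
  rw [γ.dist_initial_terminal] at ht
  refine ⟨γ.toFun t, ⟨t, ⟨h0, ht⟩, rfl⟩, ?_⟩
  have h1 := γ.isom 0 ⟨le_refl 0, γ.len_nonneg⟩ t ⟨h0, ht⟩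
  rw [initial, h1, zero_sub, abs_neg, abs_of_nonneg h0]

theorem isCompact_seg (γ : GeodesicSegment X) : IsCompact γ.seg := by
  refine isCompact_Icc.image_of_continuousOn ?_
  have h : LipschitzOnWith 1 γ.toFun (Set.Icc 0 γ.len) :=
    LipschitzOnWith.of_dist_le_mul fun s hs t ht => by
      rw [γ.isom s hs t ht, Real.dist_eq]
      simp
  exact h.continuousOn

theorem proj_nonempty (γ : GeodesicSegment X) (x : X) : (proj γ x).Nonempty := by
  obtain ⟨p, hp, h⟩ := γ.isCompact_seg.exists_infDist_eq_dist ⟨_, γ.initial_mem⟩ x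
  exact ⟨p, hp, h.symm⟩

theorem mem_seg_point (p : X) : p ∈ (point p).seg := (point p).initial_mem

end GeodesicSegment

theorem IsDeltaHyperbolic.exists_dist_lt {δ : ℝ} (hδ : 0 < δ) (hhyp : IsDeltaHyperbolic X δ)
    {γ₁ γ₂ γ₃ : GeodesicSegment X} (h₁₃ : γ₁.initial = γ₃.initial)
    (h₁₂ : γ₁.terminal = γ₂.initial) (h₂₃ : γ₂.terminal = γ₃.terminal) {m : X}
    (hm : m ∈ γ₃.seg) :
    (∃ u ∈ γ₁.seg, dist m u < 2 * δ) ∨ ∃ v ∈ γ₂.seg, dist m v < 2 * δ := by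
  have h := Metric.cthickening_subset_thickening' (by linarith) (by linarith : δ < 2 * δ) _
    (hhyp γ₁ γ₂ γ₃ h₁₃ h₁₂ h₂₃ hm)
  obtain ⟨u, hu | hu, h⟩ := Metric.mem_thickening_iff.1 h
  · exact Or.inl ⟨u, hu, h⟩
  · exact Or.inr ⟨u, hu, h⟩

/-- In a hyperbolic space, the distance from `w` to a geodesic is at most the Gromov product at
`w` of its endpoints, up to an additive error. -/
theorem IsDeltaHyperbolic.exists_dist_le {δ : ℝ} (hδ : 0 < δ) (hgeo : IsGeodesicSpace X)
    (hhyp : IsDeltaHyperbolic X δ) (γ : GeodesicSegment X) (w : X) :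
    ∃ m ∈ γ.seg, 2 * dist w m ≤
      dist w γ.initial + dist w γ.terminal - dist γ.initial γ.terminal + 8 * δ := by
  set x := γ.initial with hx
  set z := γ.terminal with hz
  obtain ⟨γ₁, hi₁, ht₁⟩ := hgeo x w
  obtain ⟨γ₂, hi₂, ht₂⟩ := hgeo w z
  have tri₁ := dist_triangle x z w
  have tri₂ := dist_triangle x w z
  have tri₃ := dist_triangle w x z
  have c₁ := dist_comm w x
  have c₂ := dist_comm w z
  obtain ⟨m, hm, hxm⟩ := γ.exists_mem_dist_eq
    (t := (dist x w + dist x z - dist w z) / 2) (by linarith) (by linarith)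
  have hsum := γ.dist_add_dist_of_mem hm
  rw [← hx] at hxm hsum
  rw [← hz] at hsum
  refine ⟨m, hm, ?_⟩
  rcases hhyp.exists_dist_lt hδ (γ₁ := γ₁) (γ₂ := γ₂) hi₁ (ht₁.trans hi₂.symm) ht₂ hm with
    ⟨u, hu, hmu⟩ | ⟨u, hu, hmu⟩
  · have hsum' := γ₁.dist_add_dist_of_mem hu
    rw [hi₁, ht₁] at hsum'
    linarith [dist_triangle x u m, dist_triangle w u m, dist_comm w u, dist_comm m u]
  · have hsum' := γ₂.dist_add_dist_of_mem hu
    rw [hi₂, ht₂] at hsum'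
    linarith [dist_triangle m u z, dist_triangle w u m, dist_comm m u]

theorem IsDeltaHyperbolic.fourPoint {δ : ℝ} (hδ : 0 < δ) (hgeo : IsGeodesicSpace X)
    (hhyp : IsDeltaHyperbolic X δ) : FourPoint X (12 * δ) := by
  intro x y z w
  obtain ⟨γ₃, hi₃, ht₃⟩ := hgeo x z
  obtain ⟨γ₁, hi₁, ht₁⟩ := hgeo x y
  obtain ⟨γ₂, hi₂, ht₂⟩ := hgeo y z
  obtain ⟨m, hm, hwm⟩ := hhyp.exists_dist_le hδ hgeo γ₃ w
  rw [hi₃, ht₃] at hwm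
  rcases hhyp.exists_dist_lt hδ (hi₁.trans hi₃.symm) (ht₁.trans hi₂.symm) (ht₂.trans ht₃.symm)
    hm with ⟨u, hu, hmu⟩ | ⟨u, hu, hmu⟩
  · have hsum := γ₁.dist_add_dist_of_mem hu
    rw [hi₁, ht₁] at hsum
    left
    linarith [dist_triangle w m u, dist_triangle x u w, dist_triangle y u w, dist_comm y u,
      dist_comm w u, dist_comm w x, dist_comm w z]
  · have hsum := γ₂.dist_add_dist_of_mem hu
    rw [hi₂, ht₂] at hsum
    right
    linarith [dist_triangle w m u, dist_triangle z u w, dist_triangle y u w, dist_comm z u,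
      dist_comm w u, dist_comm w x, dist_comm w z]

namespace AlmostBetween

variable {C C' D κ : ℝ} {a a' b b' u v w x x' y z : X}

theorem symm (h : AlmostBetween C x a y) : AlmostBetween C y a x := by
  unfold AlmostBetween at *
  linarith [dist_comm x a, dist_comm a y, dist_comm x y]

theorem mono (h : AlmostBetween C x a y) (hC : C ≤ C') : AlmostBetween C' x a y :=
  le_trans h (by linarith)

theorem map {f : X → X} (hf : Isometry f) (h : AlmostBetween C x a y) :
    AlmostBetween C (f x) (f a) (f y) := by
  unfold AlmostBetween at *
  simpa only [hf.dist_eq] using h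

theorem extend (hX : FourPoint X κ) (h₁ : AlmostBetween C x a b) (h₂ : AlmostBetween C' a b y)
    (hab : C + C' + κ < 2 * dist a b) : AlmostBetween (C' + κ) x b y := by
  unfold AlmostBetween at *
  rcases hX x a b y with h | h <;> linarith

/-- If `x` comes before the pair `(a, b)`, and the pair `(a, b)` comes before `(a', b')`, then `x`
comes before `(a', b')`. -/
theorem step (hX : FourPoint X κ) (h₁ : AlmostBetween C' x a b) (h₂ : AlmostBetween C a b b')
    (h₃ : AlmostBetween C b a' b') (hab : C' + C + κ < 2 * dist a b) :
    AlmostBetween (2 * C + κ) x a' b' := by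
  have h := h₁.extend hX h₂ hab
  unfold AlmostBetween at *
  linarith [dist_triangle x b a']

/-- If `y` and `z` are both behind `b` as seen from `a`, so is every point `w` almost between `y`
and `z`. -/
theorem of_almostBetween (hX : FourPoint X κ) (hC' : 0 ≤ C') (hC : 0 ≤ C) (hκ : 0 ≤ κ)
    (hy : AlmostBetween C a b y) (hz : AlmostBetween C a b z) (hw : AlmostBetween C' y w z) :
    AlmostBetween (C' + 2 * C + 2 * κ) a b w := by
  unfold AlmostBetween at *
  by_contra! hcon
  have key : ∀ p, dist a b + dist b p ≤ dist a p + C →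
      dist b p + dist b w ≤ dist p w + C + κ := by
    intro p hp
    rcases hX a b p w with h | h <;> linarith
  linarith [key y hy, key z hz, dist_triangle a w b, dist_comm w b, dist_comm w z,
    dist_triangle y b z, dist_comm y b]

theorem replace (hX : FourPoint X κ) {K : ℝ} (h : AlmostBetween C x' u z) (hK : dist x x' < K)
    (hu : 2 * K + C + κ < 2 * dist x' u) : AlmostBetween (C + κ) x u z := by
  unfold AlmostBetween at *
  rcases hX x' x z u with h' | h'
  · linarith [dist_triangle x' x u, dist_comm x x', dist_comm z u]
  · linarith [dist_comm x u]

theorem dist_le (hX : FourPoint X κ) (hu : AlmostBetween C x u y) (hv : AlmostBetween C x v y)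
    (hle : |dist x u - dist x v| ≤ D) : dist u v ≤ C + D + κ := by
  unfold AlmostBetween at *
  have := abs_le.1 hle
  rcases hX u x v y with h | h <;>
    linarith [dist_comm x u]

end AlmostBetween

/-! ### Consequences of alignment -/

theorem almostBetween_of_mem_proj {κ : ℝ} (hX : FourPoint X κ) (hκ : 0 < κ)
    (γ : GeodesicSegment X) {x p : X} (hp : p ∈ proj γ x) {b : X} (hb : b ∈ γ.seg) :
    AlmostBetween (3 * κ) x p b := by
  have hmin : ∀ w ∈ γ.seg, dist x p ≤ dist x w := fun w hw => by
    rw [hp.2]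
    exact Metric.infDist_le_dist_of_mem hw
  have key : ∀ w ∈ γ.seg, dist p w = 2 * κ → dist p w + dist w b = dist p b →
      AlmostBetween (3 * κ) x p b := by
    intro w hw hpw hsum
    have := hmin w hw
    unfold AlmostBetween
    rcases hX x p w b with h | h <;> linarith
  by_cases hlt : dist p b < 2 * κ
  · have := hmin b hb
    unfold AlmostBetween
    linarith
  push Not at hlt
  obtain ⟨⟨s, hs, rfl⟩, -⟩ := id hp
  obtain ⟨r, hr, rfl⟩ := hb
  have hsr := γ.isom s hs r hr
  rw [hsr] at hlt
  rcases le_total s r with hle | hle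
  · rw [abs_of_nonpos (by linarith)] at hlt hsr
    have ht : s + 2 * κ ∈ Set.Icc 0 γ.len := ⟨by linarith [hs.1], by linarith [hr.2]⟩
    have h1 := γ.isom s hs _ ht
    have h2 := γ.isom _ ht r hr
    rw [abs_of_nonpos (by linarith)] at h1 h2
    exact key _ ⟨_, ht, rfl⟩ (by linarith) (by linarith)
  · rw [abs_of_nonneg (by linarith)] at hlt hsr
    have ht : s - 2 * κ ∈ Set.Icc 0 γ.len := ⟨by linarith [hr.1], by linarith [hs.2]⟩
    have h1 := γ.isom s hs _ ht
    have h2 := γ.isom _ ht r hr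
    rw [abs_of_nonneg (by linarith)] at h1 h2
    exact key _ ⟨_, ht, rfl⟩ (by linarith) (by linarith)

theorem almostBetween_of_diam_lt {κ K : ℝ} (hX : FourPoint X κ) (hκ : 0 < κ)
    (γ : GeodesicSegment X) {A : Set X} {e b x : X} (he : e ∈ γ.seg) (hb : b ∈ γ.seg)
    (hdiam : Metric.diam (projSet γ A ∪ {e}) < K) (hx : x ∈ A) :
    AlmostBetween (2 * K + 3 * κ) x e b := by
  obtain ⟨p, hp⟩ := γ.proj_nonempty x
  have hsub : projSet γ A ∪ {e} ⊆ γ.seg := by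
    rintro q (hq | hq)
    · obtain ⟨y, -, hy⟩ := Set.mem_iUnion₂.1 hq
      exact hy.1
    · rwa [Set.mem_singleton_iff.1 hq]
  have hpe : dist p e < K := lt_of_le_of_lt
    (Metric.dist_le_diam_of_mem (γ.isCompact_seg.isBounded.subset hsub)
      (Or.inl (Set.mem_iUnion₂.2 ⟨x, hx, hp⟩)) (Or.inr rfl)) hdiam
  have h := almostBetween_of_mem_proj hX hκ γ hp hb
  unfold AlmostBetween at *
  linarith [dist_triangle x p e, dist_triangle e p b, dist_comm e p]

theorem AlignedPair.almostBetween_left {κ K : ℝ} (hX : FourPoint X κ) (hκ : 0 < κ)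
    {γ η : GeodesicSegment X} (h : AlignedPair K γ η) {y : X} (hy : y ∈ η.seg) :
    AlmostBetween (2 * K + 3 * κ) γ.initial γ.terminal y :=
  (almostBetween_of_diam_lt hX hκ γ γ.terminal_mem γ.initial_mem h.1 hy).symm

theorem AlignedPair.almostBetween_right {κ K : ℝ} (hX : FourPoint X κ) (hκ : 0 < κ)
    {γ η : GeodesicSegment X} (h : AlignedPair K γ η) {x : X} (hx : x ∈ γ.seg) :
    AlmostBetween (2 * K + 3 * κ) x η.initial η.terminal :=
  almostBetween_of_diam_lt hX hκ η η.initial_mem η.terminal_mem h.2 hx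

/-! ### Chains of pairs of points -/

/-- The pair `(a, b)` comes before the pair `(a', b')`, up to an error `C`: both `a'` and `b'` are
behind `b` as seen from `a`, and both `a` and `b` are behind `a'` as seen from `b'`. -/
structure Consecutive (C : ℝ) (a b a' b' : X) : Prop where
  fst_left : AlmostBetween C a b a'
  snd_left : AlmostBetween C a b b'
  fst_right : AlmostBetween C a a' b'
  snd_right : AlmostBetween C b a' b'

namespace Consecutive

variable {C C' κ : ℝ} {a b a' b' : X}

theorem mono (h : Consecutive C a b a' b') (hC : C ≤ C') : Consecutive C' a b a' b' :=
  ⟨h.fst_left.mono hC, h.snd_left.mono hC, h.fst_right.mono hC, h.snd_right.mono hC⟩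

theorem map {f : X → X} (hf : Isometry f) (h : Consecutive C a b a' b') :
    Consecutive C (f a) (f b) (f a') (f b') :=
  ⟨h.fst_left.map hf, h.snd_left.map hf, h.fst_right.map hf, h.snd_right.map hf⟩

theorem almostBetween_forward (hX : FourPoint X κ) {a b : ℕ → X} {n : ℕ}
    (h : ∀ i < n, Consecutive C (a i) (b i) (a (i + 1)) (b (i + 1)))
    (hD : ∀ i, 3 * C + 2 * κ < 2 * dist (a i) (b i)) {x : X}
    (hx : AlmostBetween (2 * C + κ) x (a 0) (b 0)) :
    ∀ i ≤ n, AlmostBetween (2 * C + κ) x (a i) (b i) := by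
  intro i
  induction i with
  | zero => exact fun _ => hx
  | succ i ih =>
    intro hi
    have hc := h i hi
    exact (ih (by lia)).step hX hc.snd_left hc.snd_right (by linarith [hD i])

theorem almostBetween_backward (hX : FourPoint X κ) {a b : ℕ → X} {n : ℕ}
    (h : ∀ i < n, Consecutive C (a i) (b i) (a (i + 1)) (b (i + 1)))
    (hD : ∀ i, 3 * C + 2 * κ < 2 * dist (a i) (b i)) {y : X}
    (hy : AlmostBetween (2 * C + κ) (a n) (b n) y) :
    ∀ i ≤ n, AlmostBetween (2 * C + κ) (a i) (b i) y := by
  intro i hi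
  induction hi using Nat.decreasingInduction with
  | self => exact hy
  | of_succ i hi ih =>
    have hc := h i hi
    exact (ih.symm.step hX hc.fst_right.symm hc.fst_left.symm
      (by linarith [hD (i + 1), dist_comm (a (i + 1)) (b (i + 1))])).symm

theorem almostBetween_endpoints (hX : FourPoint X κ) (hC : 0 ≤ C) (hκ : 0 ≤ κ) {a b : ℕ → X}
    {n : ℕ} (h : ∀ i < n, Consecutive C (a i) (b i) (a (i + 1)) (b (i + 1)))
    (hD : ∀ i, 4 * C + 3 * κ < 2 * dist (a i) (b i)) {x y : X}
    (hx : AlmostBetween (2 * C + κ) x (a 0) (b 0))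
    (hy : AlmostBetween (2 * C + κ) (a n) (b n) y) :
    ∀ i ≤ n, AlmostBetween (2 * C + 2 * κ) x (a i) y ∧
      AlmostBetween (2 * C + 2 * κ) x (b i) y := by
  intro i hi
  have hD' : ∀ i, 3 * C + 2 * κ < 2 * dist (a i) (b i) := fun i => by linarith [hD i]
  have hx' := almostBetween_forward hX h hD' hx i hi
  have hy' := almostBetween_backward hX h hD' hy i hi
  have hi := hD i
  constructor
  · exact (hy'.symm.extend hX hx'.symm (by rw [dist_comm]; linarith)).symm.mono (by linarith)
  · exact (hx'.extend hX hy' (by linarith)).mono (by linarith)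

theorem le_dist (hX : FourPoint X κ) {a b : ℕ → X}
    (h : ∀ i, Consecutive C (a i) (b i) (a (i + 1)) (b (i + 1)))
    (hC : 0 ≤ C) (hκ : 0 ≤ κ)
    (hD : ∀ i, 2 * C + 2 * κ + 1 ≤ dist (a i) (b i)) {x : X}
    (hx : AlmostBetween (2 * C + κ) x (a 0) (b 0)) (j : ℕ) :
    (j : ℝ) ≤ dist x (b j) := by
  induction j with
  | zero => simp
  | succ j ih =>
    have hb := almostBetween_forward hX (n := j) (fun i _ => h i)
      (fun i => by linarith [hD i]) hx j le_rfl
    have h1 := hb.extend hX (h j).snd_left (by linarith [hD j])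
    have h2 := (h j).snd_right
    unfold AlmostBetween at h1 h2
    push_cast
    linarith [hD (j + 1), dist_nonneg (x := b j) (y := a (j + 1))]

/-- The last pair of a chain from `x` to `f x` comes before the image under `f` of the first
pair. -/
theorem of_isometry (hX : FourPoint X κ) (hC : 0 ≤ C) (hκ : 0 ≤ κ) {f : X → X} (hf : Isometry f)
    {a b : ℕ → X} {n : ℕ} (h : ∀ i < n, Consecutive C (a i) (b i) (a (i + 1)) (b (i + 1)))
    (hD : ∀ i, 4 * C + 3 * κ < 2 * dist (a i) (b i)) {x : X}
    (hx : AlmostBetween C x (a 0) (b 0)) (hfx : AlmostBetween C x (f (a 0)) (f (b 0)))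
    (hy : AlmostBetween C (a n) (b n) (f x)) (hfy : AlmostBetween C (a n) (b n) (f (f x))) :
    Consecutive (4 * C + 4 * κ) (a n) (b n) (f (a 0)) (f (b 0)) := by
  have he := almostBetween_endpoints hX hC hκ h hD (hx.mono (by linarith))
    (hy.mono (by linarith))
  have h0 := he 0 (Nat.zero_le n)
  have hn := he n le_rfl
  have hC' : 0 ≤ 2 * C + 2 * κ := by linarith
  have hxf := hx.map hf
  refine Consecutive.mono (C := 2 * C + 2 * κ + 2 * C + 2 * κ) ⟨?_, ?_, ?_, ?_⟩ (by linarith)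
  · exact hy.of_almostBetween hX hC' hC hκ hfy (h0.1.map hf)
  · exact hy.of_almostBetween hX hC' hC hκ hfy (h0.2.map hf)
  · exact (hfx.symm.of_almostBetween hX hC' hC hκ hxf.symm hn.1).symm
  · exact (hfx.symm.of_almostBetween hX hC' hC hκ hxf.symm hn.2).symm

end Consecutive

/-! ### Loxodromic elements and the WPD property -/

theorem isLoxodromic_of_le_dist {ρ : G → X → X} (hisom : ∀ g : G, Isometry (ρ g))
    (hmul : ∀ g h : G, ∀ x : X, ρ (g * h) x = ρ g (ρ h x)) {x0 : X} {g : G} {c : ℝ}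
    (h : ∀ n : ℕ, (n : ℝ) - c ≤ dist x0 (ρ (g ^ n) x0)) : IsLoxodromic ρ x0 g := by
  have hsub : Subadditive fun n : ℕ => dist x0 (ρ (g ^ n) x0) := by
    intro m n
    have := dist_triangle x0 (ρ (g ^ m) x0) (ρ (g ^ (m + n)) x0)
    simpa only [pow_add, hmul, (hisom _).dist_eq] using this
  have hlim := hsub.tendsto_lim ⟨0, by rintro _ ⟨n, rfl⟩; positivity⟩
  refine ⟨hsub.lim, lt_of_lt_of_le one_pos ?_, hlim⟩
  have h1 : Filter.Tendsto (fun n : ℕ => 1 - c / (n : ℝ)) Filter.atTop (nhds 1) := by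
    simpa using (tendsto_const_div_atTop_nhds_zero_nat c).const_sub 1
  refine le_of_tendsto_of_tendsto h1 hlim ?_
  filter_upwards [Filter.eventually_gt_atTop 0] with n hn
  have hn' : (0 : ℝ) < n := by exact_mod_cast hn
  rw [le_div_iff₀ hn', sub_mul, div_mul_cancel₀ _ hn'.ne', one_mul]
  exact h n

theorem IsLoxodromic.eventually_lt_dist {ρ : G → X → X} {x0 : X} {φ : G}
    (h : IsLoxodromic ρ x0 φ) (D : ℝ) :
    ∀ᶠ n : ℕ in Filter.atTop, D < dist x0 (ρ (φ ^ n) x0) := by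
  obtain ⟨τ, hτ, hlim⟩ := h
  have h1 := hlim.pos_mul_atTop hτ tendsto_natCast_atTop_atTop
  filter_upwards [h1.eventually_gt_atTop D, Filter.eventually_gt_atTop 0] with n hn hn0
  rwa [div_mul_cancel₀] at hn
  positivity

theorem exists_list_of_closure_eq_top {S : Finset G}
    (hS : Subgroup.closure (S : Set G) = ⊤) (g : G) :
    ∃ l : List G, l.length = wordLength S g ∧ (∀ x ∈ l, x ∈ S ∨ x⁻¹ ∈ S) ∧ l.prod = g := by
  refine Nat.sInf_mem
    (s := {n | ∃ l : List G, l.length = n ∧ (∀ x ∈ l, x ∈ S ∨ x⁻¹ ∈ S) ∧ l.prod = g}) ?_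
  have hg : g ∈ (Subgroup.closure (S : Set G)).toSubmonoid := hS ▸ Subgroup.mem_top g
  rw [Subgroup.closure_toSubmonoid] at hg
  obtain ⟨l, hl, hprod⟩ := Submonoid.exists_list_of_mem_closure hg
  exact ⟨l.length, l, rfl, fun x hx => hl x hx, hprod⟩

theorem finite_setOf_list_prod (S : Finset G) (n : ℕ) :
    {g : G | ∃ l : List G, l.length = n ∧ (∀ x ∈ l, x ∈ S ∨ x⁻¹ ∈ S) ∧ l.prod = g}.Finite := by
  have hT : {x : G | x ∈ S ∨ x⁻¹ ∈ S}.Finite :=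
    S.finite_toSet.union (S.finite_toSet.preimage inv_injective.injOn)
  induction n with
  | zero =>
    refine (Set.finite_singleton (1 : G)).subset ?_
    rintro g ⟨l, hl, -, rfl⟩
    simp [List.length_eq_zero_iff.1 hl]
  | succ n ih =>
    refine (hT.image2 (· * ·) ih).subset ?_
    rintro g ⟨l, hl, hmem, rfl⟩
    obtain ⟨s, l, rfl⟩ := List.exists_cons_of_length_eq_add_one hl
    rw [List.forall_mem_cons] at hmem
    exact ⟨s, hmem.1, l.prod, ⟨l, by simpa using hl, hmem.2, rfl⟩, List.prod_cons.symm⟩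

theorem finite_setOf_wordLength_lt {S : Finset G} (hS : Subgroup.closure (S : Set G) = ⊤)
    (r : ℝ) : {g : G | (wordLength S g : ℝ) < r}.Finite := by
  refine ((Set.finite_le_nat ⌊r⌋₊).biUnion fun n _ => finite_setOf_list_prod S n).subset ?_
  intro g hg
  exact Set.mem_biUnion (x := wordLength S g) (Nat.le_floor (le_of_lt hg))
    (exists_list_of_closure_eq_top hS g)

/-- Only finitely many elements move both endpoints of a long geodesic `[x₀, φ^L x₀]` by a bounded
amount. -/
theorem E0Spec.finite_setOf_dist_le {S : Finset G} (hS : Subgroup.closure (S : Set G) = ⊤)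
    {ρ : G → X → X} (hmul : ∀ g h : G, ∀ x : X, ρ (g * h) x = ρ g (ρ h x)) {x0 : X} {φ : G}
    {E0 : ℝ} (hE0 : E0Spec S ρ x0 φ E0) {L : ℕ} (hL : 0 < L) {Υ : GeodesicSegment X}
    (hi : Υ.initial = x0) (ht : Υ.terminal = ρ (φ ^ L) x0) {c : ℝ} (hc : 4 * c + E0 < Υ.len) :
    {u : G | dist (ρ u x0) x0 ≤ c ∧
      dist (ρ u (ρ (φ ^ L) x0)) (ρ (φ ^ L) x0) ≤ c}.Finite := by
  have hfin : (⋃ i ∈ {i | i ≤ L}, ⋃ j ∈ {j | j ≤ L}, (fun v => φ ^ i * v * (φ ^ j)⁻¹) ''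
      {v : G | (wordLength S v : ℝ) < E0}).Finite :=
    (Set.finite_le_nat L).biUnion fun i _ => (Set.finite_le_nat L).biUnion fun j _ =>
      (finite_setOf_wordLength_lt hS E0).image _
  refine hfin.subset ?_
  rintro u ⟨hu₁, hu₂⟩
  obtain ⟨p, hp⟩ := Υ.proj_nonempty (ρ u x0)
  obtain ⟨q, hq⟩ := Υ.proj_nonempty (ρ (u * φ ^ L) x0)
  have hp' : dist (ρ u x0) p ≤ dist (ρ u x0) x0 := by
    rw [hp.2]
    exact Metric.infDist_le_dist_of_mem (hi ▸ Υ.initial_mem)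
  have hq' : dist (ρ (u * φ ^ L) x0) q ≤ dist (ρ (u * φ ^ L) x0) (ρ (φ ^ L) x0) := by
    rw [hq.2]
    exact Metric.infDist_le_dist_of_mem (ht ▸ Υ.terminal_mem)
  rw [hmul] at hq'
  have hpi : dist Υ.initial p ≤ 2 * c := by
    rw [hi]
    linarith [dist_triangle_left x0 p (ρ u x0)]
  have hqt : dist q Υ.terminal ≤ 2 * c := by
    rw [ht]
    linarith [dist_triangle_left q (ρ (φ ^ L) x0) (ρ u (ρ (φ ^ L) x0))]
  obtain ⟨⟨s, hs, rfl⟩, -⟩ := id hp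
  obtain ⟨⟨t, ht', rfl⟩, -⟩ := id hq
  rw [GeodesicSegment.initial, Υ.isom 0 ⟨le_rfl, Υ.len_nonneg⟩ s hs, zero_sub, abs_neg,
    abs_of_nonneg hs.1] at hpi
  rw [GeodesicSegment.terminal, Υ.isom t ht' _ ⟨Υ.len_nonneg, le_rfl⟩,
    abs_of_nonpos (by linarith [ht'.2])] at hqt
  have hE0pos := hE0.1
  have hst : s ≤ t := by linarith
  obtain ⟨i, j, hi', hj', hw⟩ := hE0.2.2 L hL u Υ hi ht _ hp _ hq ⟨s, t, hs, ht', hst, rfl, rfl⟩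
    (by rw [Υ.isom s hs t ht', abs_of_nonpos (by linarith)]; linarith)
  refine Set.mem_biUnion hi' (Set.mem_biUnion hj' ⟨_, hw, ?_⟩)
  group

/-- Suppose that only finitely many elements coarsely fix both `p` and `q`, and that `p` and `q`
are almost between `x` and `y` and far away from these points. Then only finitely many elements
move both `x` and `y` by less than `K`. -/
theorem finite_setOf_dist_lt {ρ : G → X → X} (hisom : ∀ g : G, Isometry (ρ g))
    (hmul : ∀ g h : G, ∀ x : X, ρ (g * h) x = ρ g (ρ h x)) {κ C K : ℝ} (hκ : 0 ≤ κ)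
    (hX : FourPoint X κ) {x y p q : X}
    (hp : AlmostBetween C x p y) (hq : AlmostBetween C x q y)
    (hxp : 2 * K + C + 2 * κ < 2 * dist x p) (hyp : 2 * K + C + 2 * κ < 2 * dist y p)
    (hxq : 2 * K + C + 2 * κ < 2 * dist x q) (hyq : 2 * K + C + 2 * κ < 2 * dist y q)
    (hfin : {u : G | dist (ρ u p) p ≤ C + 1 + 3 * κ ∧
      dist (ρ u q) q ≤ C + 1 + 3 * κ}.Finite) :
    {h : G | dist x (ρ h x) < K ∧ dist y (ρ h y) < K}.Finite := by
  have hbound : ∀ z (h : G), dist x (ρ h x) < K → dist x (ρ h z) ≤ K + dist x z := by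
    intro z h hh
    have := dist_triangle x (ρ h x) (ρ h z)
    rw [(hisom h).dist_eq] at this
    linarith
  have hmove : ∀ (h : G) (z : X), dist x (ρ h x) < K → dist y (ρ h y) < K →
      AlmostBetween C x z y → 2 * K + C + 2 * κ < 2 * dist x z →
      2 * K + C + 2 * κ < 2 * dist y z → AlmostBetween (C + 2 * κ) x (ρ h z) y := by
    intro h z hx hy hz hxz hyz
    have h1 := (hz.map (hisom h)).replace hX hx (by rw [(hisom h).dist_eq]; linarith)
    exact (h1.symm.replace hX hy (by rw [(hisom h).dist_eq]; linarith)).symm.mono (by linarith)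
  have hclose : ∀ r s : ℝ, 0 ≤ r → 0 ≤ s → ⌊r⌋₊ = ⌊s⌋₊ → |r - s| ≤ 1 := by
    intro r s hr hs h
    have h' : (⌊r⌋₊ : ℝ) = ⌊s⌋₊ := by rw [h]
    rw [abs_le]
    constructor <;> linarith [Nat.floor_le hr, Nat.floor_le hs, Nat.lt_floor_add_one r,
      Nat.lt_floor_add_one s]
  have hquot : ∀ (h h' : G) (z : X), dist (ρ h' z) (ρ h z) ≤ C + 1 + 3 * κ →
      dist (ρ (h⁻¹ * h') z) z ≤ C + 1 + 3 * κ := by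
    intro h h' z hz
    rwa [← (hisom h).dist_eq, ← hmul, mul_inv_cancel_left]
  refine Set.Finite.of_finite_fibers
    (fun h => (⌊dist x (ρ h p)⌋₊, ⌊dist x (ρ h q)⌋₊)) ?_ ?_
  · refine ((Set.finite_le_nat ⌊K + dist x p⌋₊).prod
      (Set.finite_le_nat ⌊K + dist x q⌋₊)).subset ?_
    rintro _ ⟨h, ⟨hx, -⟩, rfl⟩
    exact ⟨Nat.floor_le_floor (hbound p h hx), Nat.floor_le_floor (hbound q h hx)⟩
  · rintro _ ⟨h, ⟨hx, hy⟩, rfl⟩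
    refine (hfin.image (h * ·)).subset ?_
    rintro h' ⟨⟨hx', hy'⟩, heq⟩
    rw [Set.mem_preimage, Set.mem_singleton_iff, Prod.mk.injEq] at heq
    refine ⟨h⁻¹ * h', ⟨hquot _ _ _ ?_, hquot _ _ _ ?_⟩, mul_inv_cancel_left _ _⟩
    · linarith [(hmove h' p hx' hy' hp hxp hyp).dist_le hX (hmove h p hx hy hp hxp hyp)
        (hclose _ _ dist_nonneg dist_nonneg heq.1)]
    · linarith [(hmove h' q hx' hy' hq hxq hyq).dist_le hX (hmove h q hx hy hq hxq hyq)
        (hclose _ _ dist_nonneg dist_nonneg heq.2)]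

theorem Consecutive.periodic {ρ : G → X → X} (hisom : ∀ g : G, Isometry (ρ g))
    (hmul : ∀ g h : G, ∀ x : X, ρ (g * h) x = ρ g (ρ h x)) {C : ℝ} {g : G} {ψ : ℕ → G} {n : ℕ}
    {x e : X}
    (h : ∀ i < n, Consecutive C (ρ (ψ i) x) (ρ (ψ i) e) (ρ (ψ (i + 1)) x) (ρ (ψ (i + 1)) e))
    (hn : Consecutive C (ρ (ψ n) x) (ρ (ψ n) e) (ρ g (ρ (ψ 0) x)) (ρ g (ρ (ψ 0) e))) (j : ℕ) :
    Consecutive C (ρ (g ^ (j / (n + 1)) * ψ (j % (n + 1))) x)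
      (ρ (g ^ (j / (n + 1)) * ψ (j % (n + 1))) e)
      (ρ (g ^ ((j + 1) / (n + 1)) * ψ ((j + 1) % (n + 1))) x)
      (ρ (g ^ ((j + 1) / (n + 1)) * ψ ((j + 1) % (n + 1))) e) := by
  obtain ⟨k, r, hr, rfl⟩ : ∃ k r, r < n + 1 ∧ j = (n + 1) * k + r :=
    ⟨j / (n + 1), j % (n + 1), Nat.mod_lt _ n.succ_pos, (Nat.div_add_mod _ _).symm⟩
  rw [Nat.mul_add_div n.succ_pos, Nat.mul_add_mod, Nat.div_eq_of_lt hr, Nat.mod_eq_of_lt hr,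
    add_zero]
  rcases Nat.lt_succ_iff_lt_or_eq.1 hr with hr' | rfl
  · rw [add_assoc, Nat.mul_add_div n.succ_pos, Nat.mul_add_mod,
      Nat.div_eq_of_lt (Nat.succ_lt_succ hr'), Nat.mod_eq_of_lt (Nat.succ_lt_succ hr'), add_zero]
    simp only [hmul]
    exact (h r hr').map (hisom _)
  · rw [add_assoc, ← Nat.mul_succ, Nat.mul_div_cancel_left _ r.succ_pos, Nat.mul_mod_right]
    simp only [pow_succ, hmul]
    exact hn.map (hisom _)

theorem isLoxodromic_and_hasWPD_of_chain {ρ : G → X → X} (hisom : ∀ g : G, Isometry (ρ g))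
    (hmul : ∀ g h : G, ∀ x : X, ρ (g * h) x = ρ g (ρ h x)) {κ C c : ℝ} (hκ : 0 ≤ κ) (hC : 0 ≤ C)
    (hX : FourPoint X κ) {g : G} {ψ : ℕ → G} {n : ℕ} {x e : X}
    (h : ∀ i < n, Consecutive C (ρ (ψ i) x) (ρ (ψ i) e) (ρ (ψ (i + 1)) x) (ρ (ψ (i + 1)) e))
    (hx : AlmostBetween C x (ρ (ψ 0) x) (ρ (ψ 0) e))
    (hgx : AlmostBetween C (ρ g⁻¹ x) (ρ (ψ 0) x) (ρ (ψ 0) e))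
    (hy : AlmostBetween C (ρ (ψ n) x) (ρ (ψ n) e) (ρ g x))
    (hgy : AlmostBetween C (ρ (ψ n) x) (ρ (ψ n) e) (ρ (g ^ 2) x))
    (hxe : 8 * C + 10 * κ + 1 ≤ dist x e) (hc : 8 * C + 13 * κ + 1 ≤ c)
    (hfin : {u : G | dist (ρ u x) x ≤ c ∧ dist (ρ u e) e ≤ c}.Finite) :
    IsLoxodromic ρ x g ∧ HasWPD ρ x g := by
  have hone : ∀ z : X, ρ 1 z = z := fun z => (hisom 1).injective (by rw [← hmul, one_mul])
  have hdist : ∀ u : G, dist (ρ u x) (ρ u e) = dist x e := fun u => (hisom u).dist_eq _ _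
  have hgx' := hgx.map (hisom g)
  rw [← hmul g g⁻¹, mul_inv_cancel, hone] at hgx'
  rw [pow_two, hmul] at hgy
  have hlast := Consecutive.of_isometry hX hC hκ (hisom g)
    (a := fun i => ρ (ψ i) x) (b := fun i => ρ (ψ i) e) h
    (fun i => by simp only [hdist]; linarith) hx hgx' hy hgy
  obtain ⟨Ψ, hΨ⟩ : ∃ Ψ : ℕ → G, Ψ = fun j => g ^ (j / (n + 1)) * ψ (j % (n + 1)) := ⟨_, rfl⟩
  have hchain : ∀ j, Consecutive (4 * C + 4 * κ) (ρ (Ψ j) x) (ρ (Ψ j) e) (ρ (Ψ (j + 1)) x)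
      (ρ (Ψ (j + 1)) e) := by
    rw [hΨ]
    exact Consecutive.periodic hisom hmul (fun i hi => (h i hi).mono (by linarith)) hlast
  have hstart : AlmostBetween (2 * (4 * C + 4 * κ) + κ) x (ρ (Ψ 0) x) (ρ (Ψ 0) e) := by
    simpa [hΨ] using hx.mono (by linarith)
  have hend : ∀ N : ℕ, AlmostBetween (2 * (4 * C + 4 * κ) + κ) (ρ (Ψ ((n + 1) * N + n)) x)
      (ρ (Ψ ((n + 1) * N + n)) e) (ρ (g ^ (N + 1)) x) := by
    intro N
    have hΨN : Ψ ((n + 1) * N + n) = g ^ N * ψ n := by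
      simp only [hΨ]
      rw [Nat.mul_add_div n.succ_pos, Nat.mul_add_mod, Nat.div_eq_of_lt n.lt_succ_self,
        Nat.mod_eq_of_lt n.lt_succ_self, add_zero]
    rw [hΨN, pow_succ, hmul, hmul, hmul]
    exact (hy.map (hisom _)).mono (by linarith)
  have hbetween : ∀ N : ℕ, ∀ j ≤ (n + 1) * N + n,
      AlmostBetween (8 * C + 10 * κ) x (ρ (Ψ j) x) (ρ (g ^ (N + 1)) x) ∧
        AlmostBetween (8 * C + 10 * κ) x (ρ (Ψ j) e) (ρ (g ^ (N + 1)) x) := by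
    intro N j hj
    have hj' := Consecutive.almostBetween_endpoints hX (by linarith) hκ
      (a := fun i => ρ (Ψ i) x) (b := fun i => ρ (Ψ i) e) (fun i _ => hchain i)
      (fun i => by simp only [hdist]; linarith) hstart (hend N) j hj
    exact ⟨hj'.1.mono (by linarith), hj'.2.mono (by linarith)⟩
  have hgrow : ∀ j : ℕ, (j : ℝ) ≤ dist x (ρ (Ψ j) e) :=
    Consecutive.le_dist hX (a := fun i => ρ (Ψ i) x) (b := fun i => ρ (Ψ i) e) hchain
      (by linarith) hκ (fun i => by simp only [hdist]; linarith) hstart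
  have hpow : ∀ N : ℕ, (N : ℝ) - (8 * C + 10 * κ + 1) ≤ dist x (ρ (g ^ N) x) := by
    rintro (_ | N)
    · push_cast
      linarith [dist_nonneg (x := x) (y := ρ (g ^ 0) x)]
    · have h1 := (hbetween N _ le_rfl).2
      have h2 := hgrow ((n + 1) * N + n)
      have h3 : (0 : ℝ) ≤ n * N := by positivity
      unfold AlmostBetween at h1
      push_cast at h2 ⊢
      linarith [dist_nonneg (x := ρ (Ψ ((n + 1) * N + n)) e) (y := ρ (g ^ (N + 1)) x),
        n.cast_nonneg (α := ℝ)]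
  refine ⟨isLoxodromic_of_le_dist hisom hmul hpow, fun K hK => ?_⟩
  obtain ⟨R, hR⟩ : ∃ R, R = 2 * K + 8 * C + 10 * κ + 2 * κ := ⟨_, rfl⟩
  obtain ⟨j, hj⟩ := exists_nat_gt (R + dist x e)
  have hxq := hgrow j
  have hxp := dist_triangle x (ρ (Ψ j) x) (ρ (Ψ j) e)
  rw [hdist] at hxp
  obtain ⟨N, hN⟩ := exists_nat_gt
    (R + dist x (ρ (Ψ j) x) + dist x (ρ (Ψ j) e) + (8 * C + 10 * κ + 1) + j)
  have hxy := hpow (N + 1)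
  push_cast at hxy
  have hjN : j ≤ (n + 1) * N + n := by
    have hle : (j : ℝ) ≤ N := by
      linarith [dist_nonneg (x := x) (y := ρ (Ψ j) x),
        dist_nonneg (x := x) (y := ρ (Ψ j) e), dist_nonneg (x := x) (y := e)]
    have hle' : j ≤ N := by exact_mod_cast hle
    nlinarith [Nat.zero_le (n * N)]
  obtain ⟨hp, hq⟩ := hbetween N j hjN
  have hyp := dist_triangle x (ρ (Ψ j) x) (ρ (g ^ (N + 1)) x)
  have hyq := dist_triangle x (ρ (Ψ j) e) (ρ (g ^ (N + 1)) x)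
  rw [dist_comm (ρ (Ψ j) _)] at hyp hyq
  have hRpos : 0 ≤ R := by linarith
  have hj0 : (0 : ℝ) ≤ j := j.cast_nonneg
  have hxe0 := dist_nonneg (x := x) (y := e)
  have hxp0 := dist_nonneg (x := x) (y := ρ (Ψ j) x)
  have hxq0 := dist_nonneg (x := x) (y := ρ (Ψ j) e)
  have hfinite := finite_setOf_dist_lt hisom hmul (K := K) hκ hX hp hq (by linarith)
    (by linarith) (by linarith) (by linarith) <| by
      refine (hfin.image fun u => Ψ j * u * (Ψ j)⁻¹).subset ?_
      have hconj : ∀ (u : G) (z : X), dist (ρ ((Ψ j)⁻¹ * u * Ψ j) z) z =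
          dist (ρ u (ρ (Ψ j) z)) (ρ (Ψ j) z) := by
        intro u z
        rw [← (hisom (Ψ j)).dist_eq, ← hmul, ← hmul]
        congr 2
        group
      rintro u ⟨hu₁, hu₂⟩
      refine ⟨(Ψ j)⁻¹ * u * Ψ j, ⟨?_, ?_⟩, by group⟩
      · rw [hconj]
        linarith
      · rw [hconj]
        linarith
  exact ⟨N + 1, _, hfinite, Nat.lt_succ_self _⟩

theorem alignedPair_of_alignedSeq {ι : Type*} {ρ : ι → X → X} {hisom : ∀ g : ι, Isometry (ρ g)}
    {K : ℝ} {Υ p q : GeodesicSegment X} {h : ℕ → ι} {n : ℕ}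
    (H : AlignedSeq K ([p] ++ transList ρ hisom Υ h (n + 1) ++ [q])) :
    AlignedPair K p (Υ.translate (ρ (h 1)) (hisom _)) ∧
    (∀ i < n, AlignedPair K (Υ.translate (ρ (h (i + 1))) (hisom _))
      (Υ.translate (ρ (h (i + 1 + 1))) (hisom _))) ∧
    AlignedPair K (Υ.translate (ρ (h (n + 1))) (hisom _)) q := by
  have H' : List.IsChain (AlignedPair K) ([p] ++ transList ρ hisom Υ h (n + 1) ++ [q]) := H
  rw [List.isChain_iff_getElem] at H'
  have hlen : ([p] ++ transList ρ hisom Υ h (n + 1) ++ [q]).length = n + 3 := by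
    simp [transList]
  refine ⟨?_, fun i hi => ?_, ?_⟩
  · simpa [transList] using H' 0 (by lia)
  · simpa [transList, List.getElem_append, hi, Nat.lt_succ_of_lt hi] using H' (i + 1) (by lia)
  · simpa [transList, List.getElem_append] using H' (n + 1) (by lia)

/-- Lemma 4.4(2): elements of `W_{L,ε}(n)` are WPD loxodromics. -/
theorem Wset_wpd {G : Type*} [Group G] {X : Type*} [MetricSpace X]
    (S : Finset G) (hSgen : Subgroup.closure (S : Set G) = ⊤)
    (hNVC : NonVirtuallyCyclic G)
    (δ : ℝ) (hδ : 0 < δ) (hgeo : IsGeodesicSpace X) (hhyp : IsDeltaHyperbolic X δ)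
    (ρ : G → X → X) (hisom : ∀ g : G, Isometry (ρ g))
    (hmul : ∀ g h : G, ∀ x : X, ρ (g * h) x = ρ g (ρ h x)) (hone : ∀ x : X, ρ 1 x = x)
    (x0 : X) (φ : G)
    (hlox : IsLoxodromic ρ x0 φ) (hwpd : HasWPD ρ x0 φ)
    (E0 : ℝ) (hE0 : E0Spec S ρ x0 φ E0) :
    ∃ L1 : ℝ, 0 < L1 ∧ ∀ L : ℕ, L1 < (L : ℝ) →
      ∀ Υ : GeodesicSegment X, Υ.initial = x0 → Υ.terminal = ρ (φ ^ L) x0 →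
      ∀ ε : ℝ, 0 < ε → ∀ n : ℕ, 1 ≤ ⌈ε * (n:ℝ)⌉₊ →
        ∀ g ∈ Wset S ρ hisom x0 δ E0 Υ ε n,
          IsLoxodromic ρ x0 g ∧ HasWPD ρ x0 g := by
  have hκ : 0 < 12 * δ := by linarith
  have hX := hhyp.fourPoint hδ hgeo
  have hE0pos := hE0.1
  set κ := 12 * δ with hκδ
  obtain ⟨C, hC⟩ : ∃ C, C = 2 * (6 * E0 + 360 * δ) + 3 * κ := ⟨_, rfl⟩
  have hC0 : 0 ≤ C := by linarith
  obtain ⟨N, hN⟩ := Filter.eventually_atTop.1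
    (hlox.eventually_lt_dist (4 * (8 * C + 13 * κ + 1) + E0))
  refine ⟨N + 1, by positivity, fun L hL Υ hi ht ε _ n hm g hg => ?_⟩
  have hNL : N + 1 < L := by exact_mod_cast hL
  have hlen := hN L (by lia)
  have hfin := hE0.finite_setOf_dist_le hSgen hmul (by lia) hi ht
    (c := 8 * C + 13 * κ + 1) (by rwa [← Υ.dist_initial_terminal, hi, ht])
  obtain ⟨-, h, hseq, hfirst, hlast⟩ := hg
  replace hlast : AlignedPair _ (Υ.translate (ρ (h ⌈ε * (n : ℝ)⌉₊)) (hisom _)) _ := hlast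
  generalize ⌈ε * (n : ℝ)⌉₊ = M at hm hseq hlast
  obtain ⟨m, rfl⟩ := Nat.exists_eq_add_of_le' hm
  obtain ⟨hpre, hmid, hpost⟩ := alignedPair_of_alignedSeq hseq
  have hinit : ∀ u : G, (Υ.translate (ρ u) (hisom u)).initial = ρ u x0 := fun u =>
    congrArg (ρ u) hi
  have hterm : ∀ u : G, (Υ.translate (ρ u) (hisom u)).terminal = ρ u (ρ (φ ^ L) x0) := fun u =>
    congrArg (ρ u) ht
  have hleft : ∀ {u : G} {η : GeodesicSegment X},
      AlignedPair (6 * E0 + 360 * δ) (Υ.translate (ρ u) (hisom u)) η → ∀ y ∈ η.seg,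
      AlmostBetween C (ρ u x0) (ρ u (ρ (φ ^ L) x0)) y := by
    intro u η hη y hy
    rw [← hinit, ← hterm, hC]
    exact hη.almostBetween_left hX hκ hy
  have hright : ∀ {u : G} {η : GeodesicSegment X},
      AlignedPair (6 * E0 + 360 * δ) η (Υ.translate (ρ u) (hisom u)) → ∀ x ∈ η.seg,
      AlmostBetween C x (ρ u x0) (ρ u (ρ (φ ^ L) x0)) := by
    intro u η hη x hx
    rw [← hinit, ← hterm, hC]
    exact hη.almostBetween_right hX hκ hx
  refine isLoxodromic_and_hasWPD_of_chain hisom hmul hκ.le hC0 hX (ψ := fun i => h (i + 1))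
    (n := m) (fun i him => ?_) (hright hpre _ (GeodesicSegment.mem_seg_point _))
    (hright hfirst _ (GeodesicSegment.mem_seg_point _))
    (hleft hpost _ (GeodesicSegment.mem_seg_point _))
    (hleft hlast _ (GeodesicSegment.mem_seg_point _)) (by linarith) le_rfl hfin
  have hmi := hmid i him
  refine ⟨hleft hmi _ ?_, hleft hmi _ ?_, hright hmi _ ?_, hright hmi _ ?_⟩
  · exact hinit (h (i + 1 + 1)) ▸ GeodesicSegment.initial_mem _
  · exact hterm (h (i + 1 + 1)) ▸ GeodesicSegment.terminal_mem _
  · exact hinit (h (i + 1)) ▸ GeodesicSegment.initial_mem _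
  · exact hterm (h (i + 1)) ▸ GeodesicSegment.terminal_mem _

end AcylCount
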